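/- Let X, Y be nonempty sets and let Φ, Ψ be mappings with domains X² and Y² respectively. If Φ and Ψ are combinatorially similar, then the semigroups B_X(P_{Φ⁻¹}) and B_Y(P_{Ψ⁻¹}) are isomorphic. -/

import Mathlib

open Set

universe u v w z

def range2 {X : Type u} {A : Type w} (Φ : X → X → A) : Set A := {a | ∃ x y, Φ x y = a}

def fiber {X : Type u} {A : Type w} (Φ : X → X → A) (a : A) : Set (X × X) :=
  {p | Φ p.1 p.2 = a}

def fibers {X : Type u} {A : Type w} (Φ : X → X → A) : Set (Set (X × X)) :=
  {R | ∃ a ∈ range2 Φ, R = fiber Φ a}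

def IsCoherent {X : Type u} {A : Type w} (Φ : X → X → A) (a₀ : A) : Prop :=
  Equivalence (fun x y => Φ x y = a₀) ∧
    ∀ x₁ x₂ x₃ x₄, Φ x₁ x₂ = a₀ → Φ x₃ x₄ = a₀ → Φ x₁ x₃ = Φ x₂ x₄

def CombSim {X : Type u} {Y : Type v} {A : Type w} {B : Type z}
    (Φ : X → X → A) (Ψ : Y → Y → B) : Prop :=
  ∃ (g : Y → X) (f : A → B), Function.Bijective g ∧
    Set.BijOn f (range2 Φ) (range2 Ψ) ∧ ∀ x y, Ψ x y = f (Φ (g x) (g y))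

def IsPseudometric {X : Type u} (d : X → X → ℝ) : Prop :=
  (∀ x y, 0 ≤ d x y) ∧ (∀ x y, d x y = d y x) ∧ (∀ x, d x x = 0) ∧
    ∀ x y z, d x y ≤ d x z + d z y

noncomputable instance relSemigroup {X : Type u} : Semigroup (Set (X × X)) where
  mul R T := {p : X × X | ∃ zz, (p.1, zz) ∈ R ∧ (zz, p.2) ∈ T}
  mul_assoc R S T := by
    ext p
    constructor
    · rintro ⟨a, ⟨b, h1, h2⟩, h3⟩
      exact ⟨b, h1, a, h2, h3⟩
    · rintro ⟨b, h1, a, h2, h3⟩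
      exact ⟨a, ⟨b, h1, h2⟩, h3⟩

/-- Transport of binary relations along a bijection, as an isomorphism of semigroups. -/
def relCongr {X : Type u} {Y : Type v} (e : Y ≃ X) : Set (X × X) ≃* Set (Y × Y) where
  toFun R := Prod.map e e ⁻¹' R
  invFun R := Prod.map e.symm e.symm ⁻¹' R
  left_inv R := by ext ⟨x, y⟩; simp
  right_inv R := by ext ⟨x, y⟩; simp
  map_mul' R T := by
    ext ⟨x, y⟩
    exact e.symm.exists_congr_left.trans (by rfl)

theorem fiber_comp {X : Type u} {Y : Type v} {A : Type w} {B : Type z}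
    {Φ : X → X → A} {Ψ : Y → Y → B} {g : Y → X} {f : A → B}
    (hf : Set.InjOn f (range2 Φ)) (h : ∀ x y, Ψ x y = f (Φ (g x) (g y)))
    {a : A} (ha : a ∈ range2 Φ) : Prod.map g g ⁻¹' fiber Φ a = fiber Ψ (f a) := by
  ext ⟨x, y⟩
  simpa [fiber, h] using (hf.eq_iff ⟨g x, g y, rfl⟩ ha).symm

theorem image_fibers {X : Type u} {Y : Type v} {A : Type w} {B : Type z}
    {Φ : X → X → A} {Ψ : Y → Y → B} (e : Y ≃ X) {f : A → B}
    (hf : Set.BijOn f (range2 Φ) (range2 Ψ)) (h : ∀ x y, Ψ x y = f (Φ (e x) (e y))) :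
    relCongr e '' fibers Φ = fibers Ψ := by
  ext R
  constructor
  · rintro ⟨_, ⟨a, ha, rfl⟩, rfl⟩
    exact ⟨f a, hf.mapsTo ha, fiber_comp hf.injOn h ha⟩
  · rintro ⟨_, hb, rfl⟩
    obtain ⟨a, ha, rfl⟩ := hf.surjOn hb
    exact ⟨fiber Φ a, ⟨a, ha, rfl⟩, fiber_comp hf.injOn h ha⟩

/-- Proposition 4.14: if `Φ` and `Ψ` (with domains `X²` and `Y²`) are combinatorially
similar, then the semigroups of binary relations generated by their fibers,
`B_X(P_{Φ⁻¹})` and `B_Y(P_{Ψ⁻¹})`, are isomorphic. -/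
theorem fiber_semigroups_isomorphic_of_combSim {X : Type u} {Y : Type v} {A : Type w}
    {B : Type z} [Nonempty X] [Nonempty Y]
    (Φ : X → X → A) (Ψ : Y → Y → B) (h : CombSim Φ Ψ) :
    Nonempty ((Subsemigroup.closure (fibers Φ)) ≃* (Subsemigroup.closure (fibers Ψ))) := by
  obtain ⟨g, f, hg, hf, h⟩ := h
  let e := Equiv.ofBijective g hg
  have hc : (Subsemigroup.closure (fibers Φ)).map (relCongr e : _ →ₙ* _) =
      Subsemigroup.closure (fibers Ψ) := by
    rw [MulHom.map_mclosure]
    exact congrArg _ (image_fibers e hf h)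
  exact ⟨((relCongr e).subsemigroupMap _).trans (MulEquiv.subsemigroupCongr hc)⟩
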